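/- Let a, c be integers with c > 0, q₁q₂ | c, and gcd(a, c) = 1. If a² ≡ 1 (mod c) and ψ(a) = −χ₂(−1), where ψ = χ₁χ̄₂, then S_{χ₁,χ₂}(a, c) = 0. -/

import Mathlib

open scoped MatrixGroups
open CongruenceSubgroup Matrix

/-- The first Bernoulli function `B₁(x)`: equal to `x - ⌊x⌋ - 1/2` for non-integral `x`
and `0` for integral `x`. -/
noncomputable def B1 (x : ℝ) : ℝ := if Int.fract x = 0 then 0 else Int.fract x - 1/2

/-- The newform Dedekind sum `S_{χ₁,χ₂}(a, c)`. -/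
noncomputable def ded {q₁ q₂ : ℕ} (χ₁ : DirichletCharacter ℂ q₁)
    (χ₂ : DirichletCharacter ℂ q₂) (a c : ℤ) : ℂ :=
  ∑ j ∈ Finset.range c.toNat, ∑ n ∈ Finset.range q₁,
    (starRingEnd ℂ) (χ₂ (j : ZMod q₂)) * (starRingEnd ℂ) (χ₁ (n : ZMod q₁)) *
      ((B1 ((j : ℝ) / (c : ℝ)) * B1 ((n : ℝ) / (q₁ : ℝ) + (a : ℝ) * (j : ℝ) / (c : ℝ)) : ℝ) : ℂ)

/-- The character `ψ = χ₁ · χ̄₂` modulo `q₁ q₂`. -/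
noncomputable def psiChar {q₁ q₂ : ℕ} (χ₁ : DirichletCharacter ℂ q₁)
    (χ₂ : DirichletCharacter ℂ q₂) : DirichletCharacter ℂ (q₁ * q₂) :=
  DirichletCharacter.changeLevel ⟨q₂, rfl⟩ χ₁ *
    DirichletCharacter.changeLevel ⟨q₁, mul_comm q₁ q₂⟩ (χ₂.ringHomComp (starRingEnd ℂ))


theorem B1_add_int (x : ℝ) (m : ℤ) : B1 (x + m) = B1 x := by
  simp [B1]

theorem sum_range_zmod (N : ℕ) [NeZero N] (g : ZMod N → ℂ) :
    ∑ j ∈ Finset.range N, g (j : ZMod N) = ∑ x : ZMod N, g x := by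
  refine Finset.sum_nbij' (fun j => (j : ZMod N)) (fun x => x.val) ?_ ?_ ?_ ?_ ?_
  · intro j _; simp
  · intro x _; simpa using ZMod.val_lt x
  · intro j hj; exact ZMod.val_cast_of_lt (by simpa using hj)
  · intro x _; simp
  · intro j _; rfl

/-- The Bernoulli function on residue classes. -/
noncomputable def Bz (N : ℕ) (x : ZMod N) : ℝ := B1 ((x.val : ℝ) / N)

theorem Bz_int (N : ℕ) [NeZero N] (m : ℤ) : Bz N (m : ZMod N) = B1 ((m : ℝ) / N) := by
  have hN : (N : ℝ) ≠ 0 := by exact_mod_cast NeZero.ne N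
  have h : ((m : ZMod N).val : ℤ) = m % N := ZMod.val_intCast m
  have h2 : (m : ℝ) / N = (((m : ZMod N).val : ℤ) : ℝ) / N + ((m / N : ℤ) : ℝ) := by
    rw [h]
    have h3 : ((m % N : ℤ) : ℝ) + N * ((m / N : ℤ) : ℝ) = m := by
      exact_mod_cast Int.emod_add_mul_ediv m N
    field_simp
    linarith
  rw [h2, B1_add_int]
  simp [Bz]

theorem sq_one_conj (z : ℂ) (h : z * z = 1) : (starRingEnd ℂ) z = z := by
  rcases mul_self_eq_one_iff.mp h with h | h <;> simp [h]

/-- If `a² ≡ 1 (mod c)` and `ψ(a) = −χ₂(−1)` then `S_{χ₁,χ₂}(a, c) = 0`. -/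
theorem ded_eq_zero_of_sq_eq_one {q₁ q₂ : ℕ} (hq₁ : 1 < q₁) (hq₂ : 1 < q₂)
    (χ₁ : DirichletCharacter ℂ q₁) (χ₂ : DirichletCharacter ℂ q₂)
    (h₁ : χ₁.IsPrimitive) (h₂ : χ₂.IsPrimitive)
    (hpar : χ₁ (-1) * χ₂ (-1) = 1)
    (a c : ℤ) (hc : 0 < c) (hdvd : ((q₁ * q₂ : ℕ) : ℤ) ∣ c) (hcop : IsCoprime a c)
    (hsq : a ^ 2 ≡ 1 [ZMOD c])
    (hpsi : psiChar χ₁ χ₂ ((a : ZMod (q₁ * q₂))) = - χ₂ (-1)) :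
    ded χ₁ χ₂ a c = 0 := by 
  have hq1 : NeZero q₁ := ⟨by omega⟩
  have hq2 : NeZero q₂ := ⟨by omega⟩
  obtain ⟨N, rfl⟩ : ∃ N : ℕ, c = N := ⟨c.toNat, by omega⟩
  have hN : NeZero N := ⟨by omega⟩
  have hdvd' : q₁ * q₂ ∣ N := by exact_mod_cast hdvd
  have hd1 : q₁ ∣ N := (Dvd.intro _ rfl).trans hdvd'
  have hd2 : q₂ ∣ N := (Dvd.intro_left _ rfl).trans hdvd'
  obtain ⟨M, hM⟩ := hd1
  have hMq : q₂ ∣ M := by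
    rw [hM] at hdvd'
    exact Nat.dvd_of_mul_dvd_mul_left (by omega) hdvd'
  have haN : (a : ZMod N) * a = 1 := by
    have := (ZMod.intCast_eq_intCast_iff _ _ N).mpr hsq
    push_cast at this
    rw [← this]; ring
  have ha1 : (a : ZMod q₁) * a = 1 := by
    have := congrArg (ZMod.castHom (Dvd.intro M hM.symm) (ZMod q₁)) haN
    rwa [map_mul, map_intCast, map_one] at this
  have ha2 : (a : ZMod q₂) * a = 1 := by
    have := congrArg (ZMod.castHom hd2 (ZMod q₂)) haN
    rwa [map_mul, map_intCast, map_one] at this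
  have hau : IsUnit (a : ZMod (q₁ * q₂)) := by
    have := congrArg (ZMod.castHom hdvd' (ZMod (q₁ * q₂))) haN
    exact IsUnit.of_mul_eq_one (a : ZMod (q₁ * q₂)) (by rwa [map_mul, map_intCast, map_one] at this)
  -- character values
  have x1 : χ₁ a * χ₁ a = 1 := by rw [← map_mul, ha1, map_one]
  have x2 : χ₂ a * χ₂ a = 1 := by rw [← map_mul, ha2, map_one]
  have hψ : χ₁ a * χ₂ a = - χ₂ (-1) := by
    rw [← hpsi, psiChar, MulChar.mul_apply]
    rw [← hau.unit_spec, DirichletCharacter.changeLevel_eq_cast_of_dvd,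
      DirichletCharacter.changeLevel_eq_cast_of_dvd, hau.unit_spec]
    rw [ZMod.cast_intCast (Dvd.intro _ rfl), ZMod.cast_intCast (Dvd.intro_left _ rfl)]
    rw [MulChar.ringHomComp_apply, sq_one_conj _ x2]
  have hkey : (starRingEnd ℂ) (χ₂ a) * (starRingEnd ℂ) (χ₁ (-a)) = -1 := by
    have : χ₁ (-a) = χ₁ (-1) * χ₁ a := by rw [← map_mul]; simp
    rw [this, ← map_mul]
    have : χ₂ a * (χ₁ (-1) * χ₁ a) = -1 := by
      linear_combination χ₁ (-1) * hψ - hpar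
    rw [this]; simp
  -- the embedding y ↦ M y
  let e : ZMod q₁ →+ ZMod N := ZMod.lift q₁ ⟨(zmultiplesHom (ZMod N)) (M : ZMod N), by
    simp only [zmultiplesHom_apply, natCast_zsmul, nsmul_eq_mul]
    rw [← Nat.cast_mul, ← hM]; simp⟩
  have he : ∀ m : ℤ, e (m : ZMod q₁) = ((m * M : ℤ) : ZMod N) := by
    intro m
    simp [e]
  have hemul : ∀ y : ZMod q₁, e (-a * y) = - a * e y := by
    intro y
    obtain ⟨m, rfl⟩ := ZMod.intCast_surjective y
    rw [he, ← Int.cast_neg, ← Int.cast_mul, he]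
    push_cast; ring
  have heq2 : ∀ y : ZMod q₁, ZMod.castHom hd2 (ZMod q₂) (e y) = 0 := by
    intro y
    obtain ⟨m, rfl⟩ := ZMod.intCast_surjective y
    rw [he, map_intCast]
    push_cast
    rw [(ZMod.natCast_eq_zero_iff M q₂).mpr hMq, mul_zero]
  let F : ZMod N × ZMod q₁ → ℂ := fun p =>
    (starRingEnd ℂ) (χ₂ (ZMod.castHom hd2 (ZMod q₂) p.1)) * (starRingEnd ℂ) (χ₁ p.2) *
      ((Bz N p.1 * Bz N (e p.2 + a * p.1) : ℝ) : ℂ)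
  have hded : ded χ₁ χ₂ a N = ∑ p, F p := by
    rw [Fintype.sum_prod_type, ← sum_range_zmod N, ded]
    rw [Int.toNat_natCast]
    refine Finset.sum_congr rfl fun j _ => ?_
    rw [← sum_range_zmod q₁]
    refine Finset.sum_congr rfl fun n _ => ?_
    simp only [F, map_natCast]
    have b1 : Bz N (j : ZMod N) = B1 ((j : ℝ) / ((N : ℤ) : ℝ)) := by
      simpa using Bz_int N j
    have b2 : Bz N (e (n : ZMod q₁) + a * (j : ZMod N)) =
        B1 ((n : ℝ) / (q₁ : ℝ) + (a : ℝ) * (j : ℝ) / ((N : ℤ) : ℝ)) := by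
      have h := Bz_int N (n * M + a * j)
      have h' := he n
      push_cast at h h'
      rw [h', h]
      congr 1
      have hNr : (N : ℝ) = q₁ * M := by exact_mod_cast hM
      have hN0 : (N : ℝ) ≠ 0 := by exact_mod_cast NeZero.ne N
      have hM0 : (M : ℝ) ≠ 0 := by rintro h0; simp [hNr, h0] at hN0
      have hq0 : (q₁ : ℝ) ≠ 0 := by exact_mod_cast NeZero.ne q₁
      rw [Int.cast_natCast, hNr]
      field_simp
    rw [b1, b2]
  let σ : ZMod N × ZMod q₁ → ZMod N × ZMod q₁ := fun p => (a * p.1 + e p.2, -a * p.2)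
  have hσ : Function.Involutive σ := by
    rintro ⟨x, y⟩
    simp only [σ, hemul]
    ext
    · simp only
      linear_combination x * haN
    · simp only
      linear_combination y * ha1
  have hF : ∀ p, F (σ p) = - F p := by
    rintro ⟨x, y⟩
    simp only [F, σ, hemul]
    have t : -(a : ZMod N) * e y + a * (a * x + e y) = x := by
      linear_combination x * haN
    rw [t, map_add, heq2, add_zero, map_mul, map_intCast, map_mul, map_mul, map_mul, map_mul,
      add_comm (e y)]
    push_cast
    linear_combination ((starRingEnd ℂ) (χ₂ (ZMod.castHom hd2 (ZMod q₂) x)) *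
      (starRingEnd ℂ) (χ₁ y) * Bz N x * Bz N (a * x + e y)) * hkey
  have hsum : ∑ p, F p = - ∑ p, F p := by
    conv_lhs => rw [← Equiv.sum_comp (hσ.toPerm σ) F]
    rw [← Finset.sum_neg_distrib]
    exact Finset.sum_congr rfl fun p _ => hF p
  rw [hded]
  exact self_eq_neg.mp hsum
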